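/- For all real α, β > −1 and all i, j ∈ ℕ: (Γ(α+β+2)/(2^{α+β+1}·Γ(α+1)·Γ(β+1)))·∫_{−1}^{1} (P_i^{(α,β)}(x)/P_i^{(α,β)}(1))·P_j^{(α,β)}(x)·(1−x)^α·(1+x)^β dx = δ_{ij}/a_i², where a_i² = Γ(β+1)·(2i+α+β+1)·Γ(i+α+β+1)/(Γ(α+β+2)·Γ(i+β+1)) and δ_{ij} is the Kronecker delta. -/

import Mathlib

open scoped BigOperators

noncomputable section

/-- The Jacobi polynomial `P_n^{(a,b)}(x)`. -/
def jacobiP (a b : ℝ) (n : ℕ) (x : ℝ) : ℝ :=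
  Real.Gamma (a + n + 1) / (n.factorial * Real.Gamma (a + b + n + 1)) *
    ∑ k ∈ Finset.range (n + 1),
      (n.choose k : ℝ) * (Real.Gamma (a + b + n + k + 1) / Real.Gamma (a + k + 1)) *
        ((x - 1) / 2) ^ k

/-- The normalizing constant `a_n`. -/
def aCoef (a b : ℝ) (n : ℕ) : ℝ :=
  Real.sqrt (Real.Gamma (b + 1) * (2 * n + a + b + 1) * Real.Gamma (n + a + b + 1) /
    (Real.Gamma (a + b + 2) * Real.Gamma (n + b + 1)))

open Polynomial MeasureTheory

/-! ### The Beta integral over the reals -/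

lemma intervalIntegrable_rpow_mul_one_sub_rpow {a b : ℝ} (ha : -1 < a) (hb : -1 < b) :
    IntervalIntegrable (fun t : ℝ => t ^ a * (1 - t) ^ b) volume 0 1 := by
  have left_half : ∀ {a : ℝ} (b : ℝ), -1 < a →
      IntervalIntegrable (fun t : ℝ => t ^ a * (1 - t) ^ b) volume 0 (1 / 2) := by
    intro a b ha
    refine (intervalIntegral.intervalIntegrable_rpow' ha).mul_continuousOn ?_
    refine ContinuousOn.rpow_const (by fun_prop) fun t ht => Or.inl ?_
    rw [Set.uIcc_of_le (by norm_num)] at ht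
    linarith [ht.2]
  refine (left_half b ha).trans ?_
  have reflected := (left_half a hb).comp_sub_left 1
  norm_num at reflected
  simpa only [mul_comm, one_div] using reflected.symm

lemma integral_rpow_mul_one_sub_rpow {a b : ℝ} (ha : -1 < a) (hb : -1 < b) :
    ∫ t in (0 : ℝ)..1, t ^ a * (1 - t) ^ b =
      Real.Gamma (a + 1) * Real.Gamma (b + 1) / Real.Gamma (a + b + 2) := by
  have hbeta := Complex.betaIntegral_eq_Gamma_mul_div (↑(a + 1)) (↑(b + 1))
    (by rw [Complex.ofReal_re]; linarith) (by rw [Complex.ofReal_re]; linarith)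
  rw [← Complex.ofReal_add, Complex.Gamma_ofReal, Complex.Gamma_ofReal, Complex.Gamma_ofReal,
    show a + 1 + (b + 1) = a + b + 2 by ring] at hbeta
  have hreal : Complex.betaIntegral (↑(a + 1)) (↑(b + 1)) =
      ((∫ t in (0 : ℝ)..1, t ^ a * (1 - t) ^ b : ℝ) : ℂ) := by
    rw [Complex.betaIntegral, ← intervalIntegral.integral_ofReal]
    refine intervalIntegral.integral_congr fun t ht => ?_
    rw [Set.uIcc_of_le zero_le_one] at ht
    push_cast [Complex.ofReal_cpow ht.1, Complex.ofReal_cpow (sub_nonneg.2 ht.2)]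
    simp
  rw [hreal] at hbeta
  exact_mod_cast hbeta

lemma integral_pow_mul_rpow_mul_one_sub_rpow {a b : ℝ} (ha : -1 < a) (hb : -1 < b) (m : ℕ) :
    ∫ t in (0 : ℝ)..1, t ^ m * (t ^ a * (1 - t) ^ b) =
      Real.Gamma (a + m + 1) * Real.Gamma (b + 1) / Real.Gamma (a + b + m + 2) := by
  have hm : (0 : ℝ) ≤ m := m.cast_nonneg
  rw [show a + b + m + 2 = a + m + b + 2 by ring,
    ← integral_rpow_mul_one_sub_rpow (by linarith : -1 < a + m) hb]
  refine intervalIntegral.integral_congr_ae (Filter.Eventually.of_forall fun t ht => ?_)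
  rw [Set.uIoc_of_le zero_le_one] at ht
  rw [Real.rpow_add_natCast ht.1.ne']
  ring

/-! ### Gamma quotients and alternating binomial sums -/

lemma Real.Gamma_add_natCast {z : ℝ} (n : ℕ) (hz : ∀ k < n, z + k ≠ 0) :
    Real.Gamma (z + n) = (ascPochhammer ℝ n).eval z * Real.Gamma z := by
  induction n with
  | zero => simp
  | succ n ih =>
    rw [ascPochhammer_succ_eval, Nat.cast_succ, ← add_assoc,
      Real.Gamma_add_one (hz n n.lt_succ_self), ih fun k hk => hz k (hk.trans n.lt_succ_self)]
    ring

lemma Real.Gamma_add_natCast_of_pos {z : ℝ} (n : ℕ) (hz : 0 < z) :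
    Real.Gamma (z + n) = (ascPochhammer ℝ n).eval z * Real.Gamma z :=
  Real.Gamma_add_natCast n fun k _ => by positivity

lemma sum_neg_one_pow_mul_choose_mul (f : ℝ → ℝ) (n : ℕ) (y : ℝ) :
    ∑ k ∈ Finset.range (n + 1), (-1) ^ k * (n.choose k : ℝ) * f (y + k) =
      (-1) ^ n * (fwdDiff 1)^[n] f y := by
  rw [fwdDiff_iter_eq_sum_shift, Finset.mul_sum]
  refine Finset.sum_congr rfl fun k hk => ?_
  obtain ⟨l, rfl⟩ := Nat.exists_eq_add_of_le (Finset.mem_range_succ_iff.1 hk)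
  have hl : ((-1 : ℝ) ^ l) * (-1) ^ l = 1 := by rw [← mul_pow]; simp
  simp only [add_tsub_cancel_left, zsmul_eq_mul, nsmul_eq_mul, mul_one, pow_add]
  push_cast
  linear_combination (-(-1 : ℝ) ^ k * ((k + l).choose k : ℝ) * f (y + k)) * hl

lemma sum_neg_one_pow_mul_choose_mul_eval {P : ℝ[X]} {n : ℕ} (hP : P.degree < n) :
    ∑ k ∈ Finset.range (n + 1), (-1) ^ k * (n.choose k : ℝ) * P.eval (k : ℝ) = 0 := by
  have hsum := sum_neg_one_pow_mul_choose_mul P.eval n 0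
  simp only [zero_add] at hsum
  rw [hsum]
  rcases eq_or_ne P 0 with rfl | hP0
  · have hzero : (fwdDiff (1 : ℝ))^[n] (fun x : ℝ => eval x 0) 0 = 0 := by
      simp [fwdDiff_iter_eq_sum_shift]
    rw [hzero, mul_zero]
  · rw [Polynomial.fwdDiff_iter_eq_zero_of_degree_lt ((natDegree_lt_iff_degree_lt hP0).2 hP)]
    simp

lemma fwdDiff_iter_inv (n : ℕ) (c : ℝ) (hc : ∀ k ≤ n, c + k ≠ 0) :
    (fwdDiff (1 : ℝ))^[n] (fun x : ℝ => x⁻¹) c =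
      (-1) ^ n * n.factorial / (ascPochhammer ℝ (n + 1)).eval c := by
  induction n generalizing c with
  | zero => simp
  | succ n ih =>
    have hshift : ∀ k ≤ n, c + 1 + k ≠ 0 := fun k hk => by
      have := hc (k + 1) (by omega)
      push_cast at this
      rwa [add_right_comm, add_assoc]
    have hc0 : c ≠ 0 := by simpa using hc 0 (Nat.zero_le _)
    have hlast : c + 1 + n ≠ 0 := hshift n le_rfl
    have hmid : (ascPochhammer ℝ n).eval (c + 1) ≠ 0 := by
      rw [Ne, ascPochhammer_eval_eq_zero_iff]
      rintro ⟨k, hk, hkc⟩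
      exact hshift k hk.le (by rw [hkc]; ring)
    have hleft : ∀ l, (ascPochhammer ℝ (l + 1)).eval c = c * (ascPochhammer ℝ l).eval (c + 1) := by
      intro l
      simp [ascPochhammer_succ_left]
    rw [Function.iterate_succ_apply', fwdDiff, ih c fun k hk => hc k (by omega), ih (c + 1) hshift,
      hleft, hleft, ascPochhammer_succ_eval, Nat.factorial_succ]
    field_simp
    push_cast
    ring

lemma sum_neg_one_pow_mul_choose_mul_eval_div {P : ℝ[X]} {n : ℕ} (hP : P.natDegree ≤ n) {c : ℝ}
    (hc : ∀ k ≤ n, c + k ≠ 0) :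
    ∑ k ∈ Finset.range (n + 1), (-1) ^ k * (n.choose k : ℝ) * (P.eval (k : ℝ) / (c + k)) =
      P.eval (-c) * n.factorial / (ascPochhammer ℝ (n + 1)).eval c := by
  set Q := P /ₘ (X - C (-c)) with hQ
  have hdiv : ∀ x, P.eval x = P.eval (-c) + (c + x) * Q.eval x := fun x => by
    conv_lhs => rw [← modByMonic_add_div P (X - C (-c)), modByMonic_X_sub_C_eq_C_eval]
    simp [hQ, add_comm]
  have hQdeg : Q.degree < n := by
    rcases eq_or_ne P 0 with hP0 | hP0
    · simp [hQ, hP0]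
    · have hpos : 0 < (X - C (-c)).degree := by rw [degree_X_sub_C]; exact one_pos
      refine (degree_divByMonic_lt P _ hP0 hpos).trans_le ?_
      exact natDegree_le_iff_degree_le.1 hP
  have hinv := sum_neg_one_pow_mul_choose_mul (fun x => x⁻¹) n c
  rw [fwdDiff_iter_inv n c hc] at hinv
  have hsplit : ∀ k ∈ Finset.range (n + 1),
      (-1) ^ k * (n.choose k : ℝ) * (P.eval (k : ℝ) / (c + k)) =
        P.eval (-c) * ((-1) ^ k * (n.choose k : ℝ) * (c + k)⁻¹) +
          (-1) ^ k * (n.choose k : ℝ) * Q.eval (k : ℝ) := fun k hk => by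
    have := hc k (Finset.mem_range_succ_iff.1 hk)
    rw [hdiv k]
    field_simp
  have hsign : ((-1 : ℝ) ^ n) * (-1) ^ n = 1 := by rw [← mul_pow]; simp
  rw [Finset.sum_congr rfl hsplit, Finset.sum_add_distrib, ← Finset.mul_sum, hinv,
    sum_neg_one_pow_mul_choose_mul_eval hQdeg]
  linear_combination
    (P.eval (-c) * n.factorial / (ascPochhammer ℝ (n + 1)).eval c) * hsign

/-! ### Moments of Jacobi polynomials in the variable `t = (1 - x) / 2` -/

/-- The coefficient of `t ^ k` in the unnormalised Jacobi polynomial, where `t = (1 - x) / 2`. -/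
def shiftedJacobiCoeff (a b : ℝ) (n k : ℕ) : ℝ :=
  (-1) ^ k * (n.choose k : ℝ) * (Real.Gamma (a + b + n + k + 1) / Real.Gamma (a + k + 1))

/-- The unnormalised Jacobi polynomial as a function of `t = (1 - x) / 2`. -/
def shiftedJacobi (a b : ℝ) (n : ℕ) (t : ℝ) : ℝ :=
  ∑ k ∈ Finset.range (n + 1), shiftedJacobiCoeff a b n k * t ^ k

@[fun_prop]
lemma continuous_shiftedJacobi (a b : ℝ) (n : ℕ) : Continuous (shiftedJacobi a b n) := by
  unfold shiftedJacobi
  fun_prop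

lemma jacobiP_one_sub_two_mul (a b : ℝ) (n : ℕ) (t : ℝ) :
    jacobiP a b n (1 - 2 * t) =
      Real.Gamma (a + n + 1) / (n.factorial * Real.Gamma (a + b + n + 1)) *
        shiftedJacobi a b n t := by
  unfold jacobiP shiftedJacobi shiftedJacobiCoeff
  congr 1
  refine Finset.sum_congr rfl fun k _ => ?_
  rw [show (1 - 2 * t - 1) / 2 = -1 * t by ring, mul_pow]
  ring

lemma jacobiP_one (a b : ℝ) (n : ℕ) (h : Real.Gamma (a + b + n + 1) ≠ 0) :
    jacobiP a b n 1 = Real.Gamma (a + n + 1) / (n.factorial * Real.Gamma (a + 1)) := by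
  have hsum : shiftedJacobi a b n 0 = Real.Gamma (a + b + n + 1) / Real.Gamma (a + 1) := by
    unfold shiftedJacobi
    rw [Finset.sum_eq_single_of_mem 0 (by simp) (fun k _ hk => by simp [hk])]
    simp [shiftedJacobiCoeff]
  have h1 := jacobiP_one_sub_two_mul a b n 0
  rw [mul_zero, sub_zero, hsum] at h1
  rw [h1]
  field_simp

section Moments

variable {a b : ℝ}

lemma integral_sum_mul_weight (ha : -1 < a) (hb : -1 < b) (c : ℕ → ℝ) {f : ℝ → ℝ}
    (hf : Continuous f) (n : ℕ) :
    ∫ t in (0 : ℝ)..1, (∑ k ∈ Finset.range n, c k * t ^ k) * f t * (t ^ a * (1 - t) ^ b) =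
      ∑ k ∈ Finset.range n,
        c k * ∫ t in (0 : ℝ)..1, t ^ k * f t * (t ^ a * (1 - t) ^ b) := by
  simp_rw [Finset.sum_mul, mul_assoc (c _), ← intervalIntegral.integral_const_mul]
  refine intervalIntegral.integral_finsetSum fun k _ => IntervalIntegrable.const_mul ?_ _
  exact (intervalIntegrable_rpow_mul_one_sub_rpow ha hb).continuousOn_mul (by fun_prop)

lemma integral_pow_mul_shiftedJacobi (ha : -1 < a) (hb : -1 < b) (n m : ℕ) :
    ∫ t in (0 : ℝ)..1, t ^ m * shiftedJacobi a b n t * (t ^ a * (1 - t) ^ b) =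
      Real.Gamma (b + 1) * ∑ k ∈ Finset.range (n + 1), (-1) ^ k * (n.choose k : ℝ) *
        ((ascPochhammer ℝ m).eval (a + 1 + k) *
          (Real.Gamma (a + b + n + k + 1) / Real.Gamma (a + b + m + k + 2))) := by
  have hswap : ∀ t, t ^ m * shiftedJacobi a b n t = (∑ k ∈ Finset.range (n + 1),
      shiftedJacobiCoeff a b n k * t ^ k) * t ^ m := fun t => by rw [mul_comm, shiftedJacobi]
  simp_rw [hswap]
  rw [integral_sum_mul_weight ha hb _ (by fun_prop), Finset.mul_sum]
  refine Finset.sum_congr rfl fun k _ => ?_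
  have hpos : 0 < a + 1 + k := by
    have : (0 : ℝ) ≤ k := k.cast_nonneg
    linarith
  have hgamma := Real.Gamma_add_natCast_of_pos m hpos
  have hne := (Real.Gamma_pos_of_pos hpos).ne'
  simp_rw [← pow_add]
  rw [integral_pow_mul_rpow_mul_one_sub_rpow ha hb, shiftedJacobiCoeff]
  push_cast
  rw [show a + (k + m) + 1 = a + 1 + k + m by ring, hgamma,
    show a + k + 1 = a + 1 + k by ring, show a + b + (k + m) + 2 = a + b + m + k + 2 by ring]
  field_simp

lemma integral_pow_mul_shiftedJacobi_of_lt (ha : -1 < a) (hb : -1 < b) {n m : ℕ} (hmn : m < n) :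
    ∫ t in (0 : ℝ)..1, t ^ m * shiftedJacobi a b n t * (t ^ a * (1 - t) ^ b) = 0 := by
  obtain ⟨l, rfl⟩ := Nat.exists_eq_add_of_lt hmn
  set P : ℝ[X] := (ascPochhammer ℝ m).comp (X + C (a + 1)) *
    (ascPochhammer ℝ l).comp (X + C (a + b + m + 2)) with hP
  have hdeg : P.degree < (m + l + 1 : ℕ) := by
    refine degree_le_natDegree.trans_lt (Nat.cast_lt.2 (Nat.lt_succ_of_le ?_))
    refine natDegree_mul_le.trans ?_
    simp only [natDegree_comp, ascPochhammer_natDegree, natDegree_X_add_C, mul_one, le_refl]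
  rw [integral_pow_mul_shiftedJacobi ha hb, ← mul_zero (Real.Gamma (b + 1)),
    ← sum_neg_one_pow_mul_choose_mul_eval hdeg]
  congr 1
  refine Finset.sum_congr rfl fun k _ => ?_
  have hpos : 0 < a + b + m + k + 2 := by
    have hk : (0 : ℝ) ≤ k := k.cast_nonneg
    have hm : (0 : ℝ) ≤ m := m.cast_nonneg
    linarith
  have hne := (Real.Gamma_pos_of_pos hpos).ne'
  have hgamma := Real.Gamma_add_natCast_of_pos l hpos
  push_cast
  rw [show a + b + (m + l + 1) + k + 1 = a + b + m + k + 2 + l by ring, hgamma,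
    mul_div_cancel_right₀ _ hne, hP]
  simp only [eval_mul, eval_comp, eval_add, eval_X, eval_C]
  ring_nf

lemma integral_pow_mul_shiftedJacobi_self (ha : -1 < a) (hb : -1 < b) {n : ℕ}
    (hn : a + b + n + 1 ≠ 0) :
    ∫ t in (0 : ℝ)..1, t ^ n * shiftedJacobi a b n t * (t ^ a * (1 - t) ^ b) =
      (-1) ^ n * n.factorial * Real.Gamma (b + n + 1) * Real.Gamma (a + b + n + 1) /
        Real.Gamma (a + b + 2 * n + 2) := by
  set c := a + b + n + 1 with hc
  have hcpos : ∀ k : ℕ, c + k ≠ 0 := fun k => by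
    rcases Nat.eq_zero_or_pos k with rfl | hk
    · simpa using hn
    · have hk' : (1 : ℝ) ≤ k := by exact_mod_cast hk
      have hn' : (0 : ℝ) ≤ n := n.cast_nonneg
      have : 0 < c + k := by linarith
      exact this.ne'
  have hcgamma : ∀ k : ℕ, Real.Gamma (c + k) ≠ 0 := fun k => by
    refine Real.Gamma_ne_zero fun m h => hcpos (k + m) ?_
    push_cast
    linarith
  have hbpos : 0 < b + 1 := by linarith
  have hbgamma := Real.Gamma_add_natCast_of_pos n hbpos
  have hgamma := Real.Gamma_add_natCast (n + 1) fun k _ => hcpos k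
  have hc0 : Real.Gamma c ≠ 0 := by simpa using hcgamma 0
  have hlast := hcgamma (n + 1)
  have hdeg : ((ascPochhammer ℝ n).comp (X + C (a + 1))).natDegree ≤ n := by
    simp only [natDegree_comp, ascPochhammer_natDegree, natDegree_X_add_C, mul_one, le_refl]
  have hsum := sum_neg_one_pow_mul_choose_mul_eval_div hdeg fun k _ => hcpos k
  have heval : ((ascPochhammer ℝ n).comp (X + C (a + 1))).eval (-c) =
      (-1) ^ n * (ascPochhammer ℝ n).eval (b + 1) := by
    simp only [eval_comp, eval_add, eval_X, eval_C]
    rw [show -c + (a + 1) = -(b + n) by rw [hc]; ring, ascPochhammer_eval_neg_eq_descPochhammer,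
      descPochhammer_eval_eq_ascPochhammer, add_sub_cancel_right]
  rw [heval] at hsum
  have hterm : ∀ k ∈ Finset.range (n + 1), (-1) ^ k * (n.choose k : ℝ) *
      ((ascPochhammer ℝ n).eval (a + 1 + k) *
        (Real.Gamma (a + b + n + k + 1) / Real.Gamma (a + b + n + k + 2))) =
      (-1) ^ k * (n.choose k : ℝ) *
        (((ascPochhammer ℝ n).comp (X + C (a + 1))).eval (k : ℝ) / (c + k)) := fun k _ => by
    have hk := hcgamma k
    rw [show a + b + n + k + 2 = c + k + 1 by rw [hc]; ring, Real.Gamma_add_one (hcpos k),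
      show a + b + n + k + 1 = c + k by rw [hc]; ring]
    simp only [eval_comp, eval_add, eval_X, eval_C]
    rw [add_comm (k : ℝ)]
    field_simp
  rw [integral_pow_mul_shiftedJacobi ha hb, Finset.sum_congr rfl hterm, hsum,
    show b + n + 1 = b + 1 + n by ring, hbgamma,
    show a + b + 2 * n + 2 = c + (n + 1 : ℕ) by rw [hc]; push_cast; ring, hgamma]
  rw [hgamma] at hlast
  have hpoch := left_ne_zero_of_mul hlast
  field_simp

lemma integral_shiftedJacobi_mul_shiftedJacobi_of_lt (ha : -1 < a) (hb : -1 < b) {i j : ℕ}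
    (hij : i < j) :
    ∫ t in (0 : ℝ)..1,
      shiftedJacobi a b i t * shiftedJacobi a b j t * (t ^ a * (1 - t) ^ b) = 0 := by
  have h := integral_sum_mul_weight ha hb (shiftedJacobiCoeff a b i)
    (continuous_shiftedJacobi a b j) (i + 1)
  refine h.trans (Finset.sum_eq_zero fun k hk => ?_)
  rw [integral_pow_mul_shiftedJacobi_of_lt ha hb (by have := Finset.mem_range.1 hk; omega),
    mul_zero]

lemma integral_shiftedJacobi_mul_shiftedJacobi_of_ne (ha : -1 < a) (hb : -1 < b) {i j : ℕ}
    (hij : i ≠ j) :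
    ∫ t in (0 : ℝ)..1,
      shiftedJacobi a b i t * shiftedJacobi a b j t * (t ^ a * (1 - t) ^ b) = 0 := by
  rcases hij.lt_or_gt with h | h
  · exact integral_shiftedJacobi_mul_shiftedJacobi_of_lt ha hb h
  · simp_rw [mul_comm (shiftedJacobi a b i _)]
    exact integral_shiftedJacobi_mul_shiftedJacobi_of_lt ha hb h

lemma integral_shiftedJacobi_mul_self (ha : -1 < a) (hb : -1 < b) {n : ℕ} (hn : a + b + n + 1 ≠ 0) :
    ∫ t in (0 : ℝ)..1, shiftedJacobi a b n t * shiftedJacobi a b n t * (t ^ a * (1 - t) ^ b) =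
      n.factorial * Real.Gamma (b + n + 1) * Real.Gamma (a + b + n + 1) /
        ((2 * n + a + b + 1) * Real.Gamma (a + n + 1)) := by
  have h := integral_sum_mul_weight ha hb (shiftedJacobiCoeff a b n)
    (continuous_shiftedJacobi a b n) (n + 1)
  refine h.trans ?_
  have hne : ∀ m : ℕ, 2 * n + a + b + 1 + m ≠ 0 := fun m h0 => by
    rcases Nat.eq_zero_or_pos (n + m) with h | h
    · obtain ⟨rfl, rfl⟩ := Nat.add_eq_zero_iff.1 h
      apply hn
      simpa using h0
    · have h' : (1 : ℝ) ≤ n + m := by exact_mod_cast h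
      have hn' : (0 : ℝ) ≤ n := n.cast_nonneg
      linarith
  have h0 : 2 * n + a + b + 1 ≠ 0 := by simpa using hne 0
  have hgamma : Real.Gamma (2 * n + a + b + 1) ≠ 0 :=
    Real.Gamma_ne_zero fun m hm => hne m (by linarith)
  rw [Finset.sum_range_succ, Finset.sum_eq_zero, zero_add,
    integral_pow_mul_shiftedJacobi_self ha hb hn, shiftedJacobiCoeff,
    show a + b + 2 * n + 2 = 2 * n + a + b + 1 + 1 by ring, Real.Gamma_add_one h0,
    show a + b + n + n + 1 = 2 * n + a + b + 1 by ring]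
  · have hsign : ((-1 : ℝ) ^ n) * (-1) ^ n = 1 := by rw [← mul_pow]; simp
    rw [Nat.choose_self, Nat.cast_one]
    field_simp
    linear_combination (Real.Gamma (b + n + 1) * Real.Gamma (a + b + n + 1) /
      Real.Gamma (a + n + 1)) * hsign
  · intro k hk
    rw [integral_pow_mul_shiftedJacobi_of_lt ha hb (Finset.mem_range.1 hk), mul_zero]

/-- The change of variables `x = 1 - 2 * t` in an integral against the Jacobi weight. -/
lemma integral_mul_jacobi_weight (f : ℝ → ℝ) :
    ∫ x in (-1 : ℝ)..1, f x * (1 - x) ^ a * (1 + x) ^ b =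
      2 ^ (a + b + 1) * ∫ t in (0 : ℝ)..1, f (1 - 2 * t) * (t ^ a * (1 - t) ^ b) := by
  have hsub := intervalIntegral.integral_comp_sub_mul (a := 0) (b := 1)
    (fun x => f x * (1 - x) ^ a * (1 + x) ^ b) (two_ne_zero (α := ℝ)) 1
  norm_num at hsub
  rw [one_div, eq_comm, inv_mul_eq_iff_eq_mul₀ two_ne_zero] at hsub
  rw [hsub, Real.rpow_add_one two_ne_zero, mul_comm _ (2 : ℝ), mul_assoc]
  congr 1
  rw [← intervalIntegral.integral_const_mul]
  refine intervalIntegral.integral_congr fun t ht => ?_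
  rw [Set.uIcc_of_le zero_le_one] at ht
  rw [show 1 + (1 - 2 * t) = 2 * (1 - t) by ring, Real.mul_rpow two_pos.le ht.1,
    Real.mul_rpow two_pos.le (sub_nonneg.2 ht.2), Real.rpow_add two_pos]
  ring

end Moments

/-- Orthogonality of Jacobi polynomials with respect to the normalised beta weight:
`(Γ(α+β+2)/(2^{α+β+1}Γ(α+1)Γ(β+1))) ∫_{−1}^{1} (P_i(x)/P_i(1)) P_j(x) (1−x)^α (1+x)^β dx
  = δ_{ij}/a_i²`. -/
theorem jacobi_orthogonality_normalised (α β : ℝ) (hα : -1 < α) (hβ : -1 < β)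
    (i j : ℕ) :
    Real.Gamma (α + β + 2) /
        ((2 : ℝ) ^ (α + β + 1) * Real.Gamma (α + 1) * Real.Gamma (β + 1)) *
      ∫ x in (-1 : ℝ)..1,
        (jacobiP α β i x / jacobiP α β i 1) * jacobiP α β j x *
          (1 - x) ^ α * (1 + x) ^ β
      = (if i = j then 1 else 0) / (aCoef α β i) ^ 2 := by
  rw [integral_mul_jacobi_weight fun x => jacobiP α β i x / jacobiP α β i 1 * jacobiP α β j x]
  have hfactor : ∀ t : ℝ,
      jacobiP α β i (1 - 2 * t) / jacobiP α β i 1 * jacobiP α β j (1 - 2 * t) *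
          (t ^ α * (1 - t) ^ β) =
        Real.Gamma (α + i + 1) / (i.factorial * Real.Gamma (α + β + i + 1)) /
            jacobiP α β i 1 *
          (Real.Gamma (α + j + 1) / (j.factorial * Real.Gamma (α + β + j + 1))) *
          (shiftedJacobi α β i t * shiftedJacobi α β j t * (t ^ α * (1 - t) ^ β)) := fun t => by
    rw [jacobiP_one_sub_two_mul, jacobiP_one_sub_two_mul]
    ring
  simp_rw [hfactor]
  rw [intervalIntegral.integral_const_mul]
  rcases ne_or_eq i j with hij | rfl
  · rw [integral_shiftedJacobi_mul_shiftedJacobi_of_ne hα hβ hij, if_neg hij]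
    simp
  have hi : (0 : ℝ) ≤ i := i.cast_nonneg
  rw [if_pos rfl]
  by_cases hn : α + β + i + 1 = 0
  -- Here `i = 0` and `Γ (α + β + 1) = Γ 0 = 0`, so both sides vanish by the conventions at poles.
  · have hn' : (i : ℝ) + α + β + 1 = 0 := by linarith
    rw [aCoef, hn, hn']
    simp
  have hαi := (Real.Gamma_pos_of_pos (by linarith : 0 < α + i + 1)).ne'
  have hα1 := (Real.Gamma_pos_of_pos (by linarith : 0 < α + 1)).ne'
  have hβi := Real.Gamma_pos_of_pos (by linarith : 0 < β + i + 1)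
  have hβ1 := Real.Gamma_pos_of_pos (by linarith : 0 < β + 1)
  have hαβ := Real.Gamma_pos_of_pos (by linarith : 0 < α + β + 2)
  have hsucc : 0 < (α + β + i + 1) * Real.Gamma (α + β + i + 1) := by
    rw [← Real.Gamma_add_one hn]
    exact Real.Gamma_pos_of_pos (by linarith)
  have hgamma : Real.Gamma (α + β + i + 1) ≠ 0 := right_ne_zero_of_mul hsucc.ne'
  have hprod : 0 < (2 * i + α + β + 1) * Real.Gamma (α + β + i + 1) := by
    rcases Nat.eq_zero_or_pos i with rfl | hipos
    · simpa using hsucc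
    · have hi1 : (1 : ℝ) ≤ i := by exact_mod_cast hipos
      exact mul_pos (by linarith) (Real.Gamma_pos_of_pos (by linarith))
  have hlin : 2 * i + α + β + 1 ≠ 0 := left_ne_zero_of_mul hprod.ne'
  have hcoef : aCoef α β i ^ 2 =
      Real.Gamma (β + 1) * ((2 * i + α + β + 1) * Real.Gamma (α + β + i + 1)) /
        (Real.Gamma (α + β + 2) * Real.Gamma (β + i + 1)) := by
    rw [aCoef, show (i : ℝ) + α + β + 1 = α + β + i + 1 by ring,
      show (i : ℝ) + β + 1 = β + i + 1 by ring, mul_assoc, Real.sq_sqrt (by positivity)]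
  have htwo : (2 : ℝ) ^ (α + β + 1) ≠ 0 := (Real.rpow_pos_of_pos two_pos _).ne'
  rw [integral_shiftedJacobi_mul_self hα hβ hn, jacobiP_one α β i hgamma, hcoef]
  field_simp
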